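/- arXiv:1906.05931 — 11 statements merged into one kernel-verified Lean document; each statement's English description precedes it below -/
import Mathlib

section
/- Let a, b, p, q be real numbers with p^2 - 4q > 0, let d = sqrt(p^2 - 4q), β = (p - d)/2, A = b - aβ, and assume A ≠ 0. For natural numbers n ≥ 1 and k ≥ 1, setting x_m = h_{m+1} - q·h_{m-1}, the de Moivre-type formula holds: ((x_n + h_n·d)/(2·A·d))^k = (x_{k·n} + h_{k·n}·d)/(2·A·d). -/
/-- Second-order linear recurrence sequence with coefficients `p, q`
and initial values `x0, x1`: `x (n+2) = p * x (n+1) - q * x n`. -/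
def rec2 (p q x0 x1 : ℝ) : ℕ → ℝ
  | 0 => x0
  | 1 => x1
  | n + 2 => p * rec2 p q x0 x1 (n + 1) - q * rec2 p q x0 x1 n

/-- The Horadam sequence `w_0 = a`, `w_1 = b`. -/
noncomputable def horadam (a b p q : ℝ) : ℕ → ℝ := rec2 p q a b

/-- The Horadam-Lucas sequence `h_0 = 2b - ap`, `h_1 = bp - 2aq`. -/
noncomputable def horadamLucas (a b p q : ℝ) : ℕ → ℝ :=
  rec2 p q (2 * b - a * p) (b * p - 2 * a * q)

/-- The sequence `u` with `u_0 = 0`, `u_1 = 1`. -/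
noncomputable def useq (p q : ℝ) : ℕ → ℝ := rec2 p q 0 1

/-- The sequence `v` with `v_0 = 2`, `v_1 = p`. -/
noncomputable def vseq (p q : ℝ) : ℕ → ℝ := rec2 p q 2 p

/-- Binet formula for the Horadam-Lucas sequence, in terms of the roots `α, β` of
`t ^ 2 - p * t + q`. -/
lemma horadamLucas_binet (a b p q α β : ℝ) (hp : α + β = p) (hq : α * β = q) (n : ℕ) :
    horadamLucas a b p q n = (b - a * β) * α ^ n + (b - a * α) * β ^ n := by
  subst hp hq
  induction n using Nat.twoStepInduction with
  | zero => simp only [horadamLucas, rec2]; ring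
  | one => simp only [horadamLucas, rec2]; ring
  | more n ih₀ ih₁ =>
    simp only [horadamLucas] at ih₀ ih₁ ⊢
    rw [rec2, ih₀, ih₁]
    ring

/-- The combination of neighbouring Horadam-Lucas numbers that isolates a power of the root `α`. -/
lemma horadamLucas_add_mul_eq (a b p q α β : ℝ) (hp : α + β = p) (hq : α * β = q)
    {m : ℕ} (hm : 1 ≤ m) :
    horadamLucas a b p q (m + 1) - q * horadamLucas a b p q (m - 1)
        + horadamLucas a b p q m * (α - β) =
      2 * (b - a * β) * (α - β) * α ^ m := by
  obtain ⟨m, rfl⟩ := Nat.exists_eq_add_of_le' hm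
  simp only [horadamLucas_binet a b p q α β hp hq, Nat.add_sub_cancel]
  subst hq
  ring

theorem deMoivre_horadamLucas (a b p q : ℝ) (hpq : p ^ 2 - 4 * q > 0)
    (d β A : ℝ) (hd : d = Real.sqrt (p ^ 2 - 4 * q))
    (hβ : β = (p - d) / 2) (hA : A = b - a * β) (hA0 : A ≠ 0)
    (n k : ℕ) (hn : 1 ≤ n) (hk : 1 ≤ k)
    (x : ℕ → ℝ)
    (hx : ∀ m : ℕ, x m = horadamLucas a b p q (m + 1) - q * horadamLucas a b p q (m - 1)) :
    ((x n + horadamLucas a b p q n * d) / (2 * A * d)) ^ k =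
      (x (k * n) + horadamLucas a b p q (k * n) * d) / (2 * A * d) := by
  have hd0 : d ≠ 0 := by rw [hd]; exact (Real.sqrt_pos.mpr hpq).ne'
  have hsq : d ^ 2 = p ^ 2 - 4 * q := by rw [hd]; exact Real.sq_sqrt hpq.le
  have hroot : ∀ m : ℕ, 1 ≤ m →
      (x m + horadamLucas a b p q m * d) / (2 * A * d) = ((p + d) / 2) ^ m := by
    intro m hm
    have h := horadamLucas_add_mul_eq a b p q ((p + d) / 2) β
      (by rw [hβ]; ring) (by rw [hβ]; linear_combination (-1 / 4) * hsq) hm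
    have hαβ : (p + d) / 2 - β = d := by rw [hβ]; ring
    rw [hαβ, ← hA, ← hx] at h
    rw [h, mul_div_cancel_left₀ _ (by positivity)]
  rw [hroot n hn, hroot (k * n) (Nat.mul_pos hk hn), ← pow_mul, mul_comm n k]
end

section
/- Let a, b, p, q be real numbers and let n ≥ 1 be a natural number. If h_{n-1}·h_{n+1} - h_n^2 ≠ 0, then the Horadam-Lucas sequence satisfies the universal recurrence h_{n+3} = (h_{n+1}^3 - 2·h_n·h_{n+1}·h_{n+2} + h_{n-1}·h_{n+2}^2)/(h_{n-1}·h_{n+1} - h_n^2). -/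
theorem universal_recurrence_horadamLucas (a b p q : ℝ) (n : ℕ) (hn : 1 ≤ n)
    (hden : horadamLucas a b p q (n - 1) * horadamLucas a b p q (n + 1) -
      horadamLucas a b p q n ^ 2 ≠ 0) :
    horadamLucas a b p q (n + 3) =
      (horadamLucas a b p q (n + 1) ^ 3 -
        2 * horadamLucas a b p q n * horadamLucas a b p q (n + 1) *
          horadamLucas a b p q (n + 2) +
        horadamLucas a b p q (n - 1) * horadamLucas a b p q (n + 2) ^ 2) /
      (horadamLucas a b p q (n - 1) * horadamLucas a b p q (n + 1) -
        horadamLucas a b p q n ^ 2) := by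
  obtain ⟨m, rfl⟩ := Nat.exists_eq_add_of_le' hn
  rw [Nat.add_sub_cancel] at hden ⊢
  have h (k : ℕ) : horadamLucas a b p q (k + 2) =
      p * horadamLucas a b p q (k + 1) - q * horadamLucas a b p q k := by
    simp only [horadamLucas, rec2]
  rw [eq_div_iff hden, show m + 1 + 3 = m + 2 + 2 from rfl,
    show m + 1 + 1 = m + 2 from rfl, h (m + 2), h (m + 1), h m]
  ring
end

section
/- Let a, b, p, q be real numbers. For every natural number n ≥ 1, the Horadam-Lucas and Horadam sequences satisfy h_n = w_{n+1} - q·w_{n-1}. -/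
theorem rec2_add_two (p q x0 x1 : ℝ) (n : ℕ) :
    rec2 p q x0 x1 (n + 2) = p * rec2 p q x0 x1 (n + 1) - q * rec2 p q x0 x1 n := by
  rw [rec2]

theorem horadamLucas_succ (a b p q : ℝ) (n : ℕ) :
    horadamLucas a b p q (n + 1) = horadam a b p q (n + 2) - q * horadam a b p q n := by
  unfold horadamLucas horadam
  induction n using Nat.twoStepInduction with
  | zero => simp only [rec2]; ring
  | one => simp only [rec2]; ring
  | more n ih₀ ih₁ =>
    rw [rec2_add_two _ _ _ _ (n + 1), rec2_add_two _ _ _ _ (n + 2), ih₀, ih₁,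
      rec2_add_two _ _ a b n]
    ring

theorem horadamLucas_eq_horadam_combination (a b p q : ℝ) (n : ℕ) (hn : 1 ≤ n) :
    horadamLucas a b p q n = horadam a b p q (n + 1) - q * horadam a b p q (n - 1) := by
  obtain ⟨m, rfl⟩ := Nat.exists_eq_add_of_le' hn
  exact horadamLucas_succ a b p q m
end

section
/- Let a, b, p, q be real numbers and set E = b^2 - abp + a^2·q. For every natural number n, h_n^2 - (p^2 - 4q)·w_n^2 = 4·E·q^n. -/
/-- The Horadam-Lucas sequence in terms of two consecutive Horadam numbers. -/
theorem horadamLucas_eq (a b p q : ℝ) (n : ℕ) :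
    horadamLucas a b p q n = 2 * horadam a b p q (n + 1) - p * horadam a b p q n := by
  unfold horadamLucas horadam
  induction n using Nat.twoStepInduction with
  | zero => simp only [rec2]; ring
  | one => simp only [rec2]; ring
  | more n ih₀ ih₁ =>
    rw [rec2, ih₀, ih₁]
    simp only [rec2]
    ring

/-- The quadratic form `y ^ 2 - p * x * y + q * x ^ 2` at consecutive Horadam numbers. -/
theorem horadam_quadratic (a b p q : ℝ) (n : ℕ) :
    horadam a b p q (n + 1) ^ 2 - p * horadam a b p q n * horadam a b p q (n + 1) +
      q * horadam a b p q n ^ 2 = (b ^ 2 - a * b * p + a ^ 2 * q) * q ^ n := by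
  unfold horadam
  induction n with
  | zero => simp only [rec2]; ring
  | succ n ih =>
    rw [rec2]
    linear_combination q * ih

theorem horadamLucas_sq_sub (a b p q : ℝ) (E : ℝ) (hE : E = b ^ 2 - a * b * p + a ^ 2 * q)
    (n : ℕ) :
    horadamLucas a b p q n ^ 2 - (p ^ 2 - 4 * q) * horadam a b p q n ^ 2 =
      4 * E * q ^ n := by
  rw [horadamLucas_eq, hE]
  linear_combination 4 * horadam_quadratic a b p q n
end

section
/- Let a, b, p, q be real numbers. For all natural numbers m and n with m ≥ n, h_{m+n} + q^n·h_{m-n} = h_m·v_n. -/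
theorem rec2_add_two_mul (p q x0 x1 : ℝ) (n k : ℕ) :
    rec2 p q x0 x1 (k + 2 * n) + q ^ n * rec2 p q x0 x1 k =
      rec2 p q x0 x1 (k + n) * vseq p q n := by
  induction n using Nat.twoStepInduction generalizing k with
  | zero => simp only [vseq, rec2, mul_zero, add_zero]; ring
  | one =>
    simp only [vseq, rec2, pow_one]
    ring
  | more n ih0 ih1 =>
    have hv : vseq p q (n + 2) = p * vseq p q (n + 1) - q * vseq p q n :=
      rec2_add_two p q 2 p n
    have h0 := ih0 (k + 2)
    have h1 := ih1 (k + 1)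
    rw [show k + 2 + 2 * n = k + 2 * n + 2 by ring, show k + 2 + n = k + (n + 2) by ring] at h0
    rw [show k + 1 + 2 * (n + 1) = k + 2 * n + 2 + 1 by ring,
      show k + 1 + (n + 1) = k + (n + 2) by ring] at h1
    rw [hv, show k + 2 * (n + 2) = k + 2 * n + 2 + 2 by ring,
      rec2_add_two p q x0 x1 (k + 2 * n + 2)]
    have hk := rec2_add_two p q x0 x1 k
    linear_combination p * h1 - q * h0 + q ^ (n + 1) * hk

theorem horadamLucas_add_add (a b p q : ℝ) (m n : ℕ) (hmn : n ≤ m) :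
    horadamLucas a b p q (m + n) + q ^ n * horadamLucas a b p q (m - n) =
      horadamLucas a b p q m * vseq p q n := by
  obtain ⟨k, rfl⟩ := Nat.exists_eq_add_of_le' hmn
  rw [Nat.add_sub_cancel, show k + n + n = k + 2 * n by ring]
  exact rec2_add_two_mul p q _ _ n k
end

section
/- Let a, b, p, q be real numbers. For all natural numbers m and n with m ≥ n, h_{m+n} - q^n·h_{m-n} = (p^2 - 4q)·w_m·u_n. -/
/-- The addition formula for the recurrence, shifting both consecutive terms at once. -/
theorem horadam_add (a b p q : ℝ) (k n : ℕ) :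
    horadam a b p q (k + n) = horadam a b p q (k + 1) * useq p q n +
        horadam a b p q k * (useq p q (n + 1) - p * useq p q n) ∧
      horadam a b p q (k + n + 1) = horadam a b p q (k + 1) * useq p q (n + 1) -
        q * horadam a b p q k * useq p q n := by
  unfold horadam useq
  induction n with
  | zero => simp [rec2]
  | succ n ih =>
    obtain ⟨ih₀, ih₁⟩ := ih
    rw [← add_assoc, rec2_add_two p q a b (k + n), rec2_add_two p q 0 1 n, ih₀, ih₁]
    constructor <;> ring

theorem pow_eq_useq (p q : ℝ) (n : ℕ) :
    q ^ n = useq p q (n + 1) ^ 2 - p * useq p q n * useq p q (n + 1) + q * useq p q n ^ 2 := by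
  unfold useq
  induction n with
  | zero => simp [rec2]
  | succ n ih =>
    rw [pow_succ, ih, rec2_add_two]
    ring

theorem horadamLucas_add_sub (a b p q : ℝ) (m n : ℕ) (hmn : n ≤ m) :
    horadamLucas a b p q (m + n) - q ^ n * horadamLucas a b p q (m - n) =
      (p ^ 2 - 4 * q) * horadam a b p q m * useq p q n := by
  obtain ⟨k, rfl⟩ := Nat.exists_eq_add_of_le' hmn
  obtain ⟨h₀, h₁⟩ := horadam_add a b p q k n
  obtain ⟨h₂, h₃⟩ := horadam_add a b p q (k + n) n
  rw [Nat.add_sub_cancel, horadamLucas_eq, horadamLucas_eq, h₂, h₃, h₀, h₁, pow_eq_useq p q n]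
  ring
end

section
/- Let a, b, p, q be real numbers with p^2 - 4q > 0, let d = sqrt(p^2 - 4q), α = (p + d)/2, β = (p - d)/2, A = b - aβ, B = b - aα. Then for every real number x, the exponential generating function of the Horadam-Lucas sequence satisfies ∑_{n=0}^∞ h_n·x^n/n! = A·e^{αx} + B·e^{βx} (the series converges to this value). -/
/-- Binet form: a second-order recurrence whose characteristic roots are `α`, `β` and whose
initial values match `A * α ^ n + B * β ^ n` agrees with it everywhere. -/
theorem rec2_eq_add_pow {p q α β : ℝ} (hα : α ^ 2 = p * α - q) (hβ : β ^ 2 = p * β - q)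
    (A B : ℝ) (n : ℕ) :
    rec2 p q (A + B) (A * α + B * β) n = A * α ^ n + B * β ^ n := by
  induction n using Nat.twoStepInduction with
  | zero => simp [rec2]
  | one => simp [rec2]
  | more n ih₀ ih₁ =>
    rw [rec2, ih₀, ih₁]
    linear_combination -A * α ^ n * hα - B * β ^ n * hβ

theorem hasSum_add_pow_mul_pow_div_factorial (A B α β x : ℝ) :
    HasSum (fun n : ℕ => (A * α ^ n + B * β ^ n) * x ^ n / n.factorial)
      (A * Real.exp (α * x) + B * Real.exp (β * x)) := by
  rw [Real.exp_eq_exp_ℝ]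
  convert! ((NormedSpace.expSeries_div_hasSum_exp (α * x)).mul_left A).add
    ((NormedSpace.expSeries_div_hasSum_exp (β * x)).mul_left B) using 2 with n
  ring

theorem horadamLucas_exp_generating_function (a b p q : ℝ) (hpq : p ^ 2 - 4 * q > 0)
    (d α β A B : ℝ) (hd : d = Real.sqrt (p ^ 2 - 4 * q))
    (hα : α = (p + d) / 2) (hβ : β = (p - d) / 2)
    (hA : A = b - a * β) (hB : B = b - a * α) (x : ℝ) :
    HasSum (fun n : ℕ => horadamLucas a b p q n * x ^ n / n.factorial)
      (A * Real.exp (α * x) + B * Real.exp (β * x)) := by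
  have hd2 : d ^ 2 = p ^ 2 - 4 * q := by rw [hd, Real.sq_sqrt hpq.le]
  have hαr : α ^ 2 = p * α - q := by rw [hα]; linear_combination hd2 / 4
  have hβr : β ^ 2 = p * β - q := by rw [hβ]; linear_combination hd2 / 4
  have h0 : 2 * b - a * p = A + B := by rw [hA, hB, hα, hβ]; ring
  have h1 : b * p - 2 * a * q = A * α + B * β := by
    rw [hA, hB, hα, hβ]; linear_combination -a / 2 * hd2
  simp only [horadamLucas, h0, h1, rec2_eq_add_pow hαr hβr]
  exact hasSum_add_pow_mul_pow_div_factorial A B α β x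
end

section
/- Let a, b, p, q be real numbers and set E = b^2 - abp + a^2·q. For all natural numbers n, r, s with n ≥ r and r ≥ s, Vajda's identity holds: h_{n+s}·h_{n-r} - h_n·h_{n-r+s} = E·q^{n-r}·(v_{r+s} - q^s·v_{r-s}). -/
/-- Two solutions of the same second-order recurrence with equal initial values coincide. -/
theorem eq_of_recurrence (p q : ℝ) {f g : ℕ → ℝ}
    (hf : ∀ n, f (n + 2) = p * f (n + 1) - q * f n)
    (hg : ∀ n, g (n + 2) = p * g (n + 1) - q * g n)
    (h0 : f 0 = g 0) (h1 : f 1 = g 1) (n : ℕ) : f n = g n := by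
  induction n using Nat.twoStepInduction with
  | zero => exact h0
  | one => exact h1
  | more n ih ih' => rw [hf, hg, ih, ih']

/-- Cassini's identity for a general second-order recurrence. -/
theorem rec2_cassini (p q x0 x1 : ℝ) (m : ℕ) :
    rec2 p q x0 x1 (m + 2) * rec2 p q x0 x1 m - rec2 p q x0 x1 (m + 1) ^ 2 =
      q ^ m * ((p * x1 - q * x0) * x0 - x1 ^ 2) := by
  induction m with
  | zero => simp [rec2]
  | succ m ih =>
    have h1 := rec2_add_two p q x0 x1 (m + 1)
    have h0 := rec2_add_two p q x0 x1 m
    rw [h1]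
    linear_combination q * ih - rec2 p q x0 x1 (m + 2) * h0

/-- d'Ocagne's identity for a general second-order recurrence. -/
theorem rec2_docagne (p q x0 x1 : ℝ) (m j : ℕ) :
    rec2 p q x0 x1 (m + 1 + j) * rec2 p q x0 x1 m -
        rec2 p q x0 x1 (m + 1) * rec2 p q x0 x1 (m + j) =
      q ^ m * ((p * x1 - q * x0) * x0 - x1 ^ 2) * useq p q j := by
  refine eq_of_recurrence p q
    (f := fun j => rec2 p q x0 x1 (m + 1 + j) * rec2 p q x0 x1 m -
      rec2 p q x0 x1 (m + 1) * rec2 p q x0 x1 (m + j))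
    (g := fun j => q ^ m * ((p * x1 - q * x0) * x0 - x1 ^ 2) * useq p q j) ?_ ?_ ?_ ?_ j
  · intro k
    simp only [← add_assoc, rec2_add_two]
    ring
  · intro k
    simp only [useq, rec2_add_two]
    ring
  · simp [useq, rec2, mul_comm]
  · simp only [useq, rec2, mul_one]
    rw [← rec2_cassini, rec2_add_two, sq]

/-- Vajda's identity for a general second-order recurrence. -/
theorem rec2_vajda (p q x0 x1 : ℝ) (m i j : ℕ) :
    rec2 p q x0 x1 (m + i + j) * rec2 p q x0 x1 m -
        rec2 p q x0 x1 (m + i) * rec2 p q x0 x1 (m + j) =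
      q ^ m * ((p * x1 - q * x0) * x0 - x1 ^ 2) * useq p q j * useq p q i := by
  refine eq_of_recurrence p q
    (f := fun i => rec2 p q x0 x1 (m + i + j) * rec2 p q x0 x1 m -
      rec2 p q x0 x1 (m + i) * rec2 p q x0 x1 (m + j))
    (g := fun i => q ^ m * ((p * x1 - q * x0) * x0 - x1 ^ 2) * useq p q j * useq p q i)
    ?_ ?_ ?_ ?_ i
  · intro k
    simp only [← add_assoc, add_right_comm _ _ j, rec2_add_two]
    ring
  · intro k
    simp only [useq, rec2_add_two]
    ring
  · simp [useq, rec2, mul_comm]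
  · simp only [useq, rec2, mul_one]
    exact rec2_docagne p q x0 x1 m j

theorem useq_add_two (p q : ℝ) (n : ℕ) :
    useq p q (n + 2) = p * useq p q (n + 1) - q * useq p q n :=
  rec2_add_two ..

theorem vseq_add_two (p q : ℝ) (n : ℕ) :
    vseq p q (n + 2) = p * vseq p q (n + 1) - q * vseq p q n :=
  rec2_add_two ..

theorem useq_quadratic (p q : ℝ) (s : ℕ) :
    useq p q (s + 1) ^ 2 - p * useq p q s * useq p q (s + 1) + q * useq p q s ^ 2 = q ^ s := by
  have h := rec2_cassini p q 0 1 s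
  rw [rec2_add_two] at h
  simp only [useq]
  linear_combination -h

theorem vseq_double (p q : ℝ) (s : ℕ) :
    vseq p q (2 * s) - q ^ s * 2 = (p ^ 2 - 4 * q) * useq p q s ^ 2 ∧
      vseq p q (2 * s + 1) - q ^ s * p =
        (p ^ 2 - 4 * q) * useq p q s * useq p q (s + 1) := by
  induction s with
  | zero => simp [vseq, useq, rec2]
  | succ s ih =>
    obtain ⟨h0, h1⟩ := ih
    have hu := useq_quadratic p q s
    have h2 : vseq p q (2 * s + 2) - q ^ (s + 1) * 2 =
        (p ^ 2 - 4 * q) * useq p q (s + 1) ^ 2 := by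
      rw [vseq_add_two]
      linear_combination p * h1 - q * h0 - (p ^ 2 - 4 * q) * hu
    refine ⟨h2, ?_⟩
    rw [show 2 * (s + 1) + 1 = 2 * s + 1 + 2 by ring, vseq_add_two, useq_add_two]
    linear_combination p * h2 - q * h1

theorem vseq_sub_eq_useq_mul (p q : ℝ) (s t : ℕ) :
    vseq p q (2 * s + t) - q ^ s * vseq p q t =
      (p ^ 2 - 4 * q) * useq p q s * useq p q (s + t) := by
  refine eq_of_recurrence p q
    (f := fun t => vseq p q (2 * s + t) - q ^ s * vseq p q t)
    (g := fun t => (p ^ 2 - 4 * q) * useq p q s * useq p q (s + t)) ?_ ?_ ?_ ?_ t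
  · intro k
    simp only [← add_assoc, vseq_add_two]
    ring
  · intro k
    simp only [← add_assoc, useq_add_two]
    ring
  · have h := (vseq_double p q s).1
    have h0 : vseq p q 0 = 2 := by simp [vseq, rec2]
    simp only [add_zero, h0]
    linear_combination h
  · have h1 : vseq p q 1 = p := by simp [vseq, rec2]
    simp only [h1]
    exact (vseq_double p q s).2

theorem vajda_horadamLucas (a b p q : ℝ) (E : ℝ) (hE : E = b ^ 2 - a * b * p + a ^ 2 * q)
    (n r s : ℕ) (hnr : r ≤ n) (hrs : s ≤ r) :
    horadamLucas a b p q (n + s) * horadamLucas a b p q (n - r) -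
        horadamLucas a b p q n * horadamLucas a b p q (n - r + s) =
      E * q ^ (n - r) * (vseq p q (r + s) - q ^ s * vseq p q (r - s)) := by
  obtain ⟨t, rfl⟩ := Nat.exists_eq_add_of_le hrs
  obtain ⟨m, rfl⟩ := Nat.exists_eq_add_of_le' hnr
  have hx := rec2_vajda p q (2 * b - a * p) (b * p - 2 * a * q) m (s + t) s
  have hv := vseq_sub_eq_useq_mul p q s t
  rw [Nat.add_sub_cancel, Nat.add_sub_cancel_left, show s + t + s = 2 * s + t by ring, hv, hE]
  simp only [horadamLucas]
  rw [hx]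
  ring
end

section
/- Let a, b, p, q be real numbers with p - q - 1 ≠ 0. For every natural number n, the partial sums of the Horadam-Lucas sequence satisfy ∑_{i=1}^n h_i = (h_{n+1} - q·h_n - h_1 + q·h_0)/(p - q - 1). -/
theorem horadamLucas_add_two (a b p q : ℝ) (n : ℕ) :
    horadamLucas a b p q (n + 2) =
      p * horadamLucas a b p q (n + 1) - q * horadamLucas a b p q n := by
  simp only [horadamLucas, rec2]

theorem sum_horadamLucas (a b p q : ℝ) (hpq : p - q - 1 ≠ 0) (n : ℕ) :
    ∑ i ∈ Finset.Icc 1 n, horadamLucas a b p q i =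
      (horadamLucas a b p q (n + 1) - q * horadamLucas a b p q n -
        horadamLucas a b p q 1 + q * horadamLucas a b p q 0) / (p - q - 1) := by
  rw [eq_div_iff hpq]
  induction n with
  | zero => simp
  | succ n ih =>
    rw [Finset.sum_Icc_succ_top (by omega), add_mul, ih, horadamLucas_add_two]
    ring
end

section
/- Let a, b, p, q be real numbers. For every natural number n, h_n = (bp - 2aq)·u_n - q·(2b - ap)·u_{n-1} when n ≥ 1, and also h_n = b·v_n - a·q·v_{n-1} when n ≥ 1. -/
theorem rec2_succ_eq_useq (p q x0 x1 : ℝ) (n : ℕ) :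
    rec2 p q x0 x1 (n + 1) = x1 * useq p q (n + 1) - q * x0 * useq p q n := by
  unfold useq
  induction n using Nat.twoStepInduction with
  | zero => simp [rec2]
  | one => simp [rec2]; ring
  | more n ih₀ ih₁ =>
    rw [rec2_add_two p q x0 x1 (n + 1), ih₀, ih₁, rec2_add_two p q 0 1 (n + 1),
      rec2_add_two p q 0 1 n]
    ring

theorem horadamLucas_succ_eq_vseq (a b p q : ℝ) (n : ℕ) :
    horadamLucas a b p q (n + 1) = b * vseq p q (n + 1) - a * q * vseq p q n := by
  unfold horadamLucas vseq
  rw [rec2_succ_eq_useq, rec2_succ_eq_useq p q 2 p]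
  cases n with
  | zero => simp [useq, rec2]; ring
  | succ n =>
    rw [rec2_succ_eq_useq p q 2 p n]
    unfold useq
    rw [rec2_add_two p q 0 1 n]
    ring

theorem horadamLucas_eq_useq_vseq (a b p q : ℝ) (n : ℕ) (hn : 1 ≤ n) :
    horadamLucas a b p q n =
        (b * p - 2 * a * q) * useq p q n - q * (2 * b - a * p) * useq p q (n - 1) ∧
      horadamLucas a b p q n = b * vseq p q n - a * q * vseq p q (n - 1) := by
  obtain ⟨n, rfl⟩ := Nat.exists_eq_add_of_le' hn
  exact ⟨rec2_succ_eq_useq .., horadamLucas_succ_eq_vseq ..⟩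
end

section
/- Let a, b, p, q be real numbers. For all natural numbers n and m with m ≥ 1, the Honsberger-type formula holds: h_{n+m} = u_m·h_{n+1} - q·u_{m-1}·h_n. -/
theorem rec2_add_add_one (p q x0 x1 : ℝ) (n k : ℕ) :
    rec2 p q x0 x1 (n + (k + 1)) =
      rec2 p q 0 1 (k + 1) * rec2 p q x0 x1 (n + 1) -
        q * rec2 p q 0 1 k * rec2 p q x0 x1 n := by
  induction k generalizing n with
  | zero => simp [rec2]
  | succ k ih =>
    rw [show n + (k + 1 + 1) = n + 1 + (k + 1) by ring, ih (n + 1)]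
    cases k <;> simp only [rec2] <;> ring

theorem honsberger_horadamLucas (a b p q : ℝ) (n m : ℕ) (hm : 1 ≤ m) :
    horadamLucas a b p q (n + m) =
      useq p q m * horadamLucas a b p q (n + 1) -
        q * useq p q (m - 1) * horadamLucas a b p q n := by
  obtain ⟨k, rfl⟩ := Nat.exists_eq_add_of_le' hm
  exact rec2_add_add_one p q _ _ n k
end
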